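/- If m ≥ 3 and x ∈ ℝ satisfies f^{(i)}(x) = 2 for some integer 0 ≤ i ≤ m−3, then q̃_m(x) = 0. If m ≥ 2 and x ∈ ℝ satisfies f^{(i)}(x) = 5 for some integer 0 ≤ i ≤ m−2, then q̃_m(x) ≠ 0. -/

import Mathlib

open Function

noncomputable section

/-- The polynomial map `f(x) = x(5-x)`. -/
def f (x : ℝ) : ℝ := x * (5 - x)

/-- `l(x) = x - 6`. -/
def lf (x : ℝ) : ℝ := x - 6

/-- `s(x) = (2-x)(4-x)(5-x) - (14-3x)`. -/
def sf (x : ℝ) : ℝ := (2 - x) * (4 - x) * (5 - x) - (14 - 3 * x)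

/-- `r(x) = -2(2-x)(5-x)`. -/
def rf (x : ℝ) : ℝ := -2 * (2 - x) * (5 - x)

/-- The decreasing inverse branch of `f`. -/
def phim (x : ℝ) : ℝ := (5 - Real.sqrt (25 - 4 * x)) / 2

/-- The increasing inverse branch of `f`. -/
def phip (x : ℝ) : ℝ := (5 + Real.sqrt (25 - 4 * x)) / 2

/-- `q m` is the function `q_m` from the paper, meaningful for `m ≥ 2`
(the values at `m = 0, 1` are junk values `1`, never used in the statements). -/
def q : ℕ → ℝ → ℝ
  | 0, _ => 1
  | 1, _ => 1
  | 2, x => sf x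
  | 3, x => sf (f x) * sf x - rf (f x) * lf x
  | m + 4, x =>
      sf (f^[m + 2] x) * q (m + 3) x - rf (f^[m + 2] x) * lf (f^[m + 1] x) * q (m + 2) x

/-- `s̃(x) = (4-x)(5-x) - 1`. -/
def st (x : ℝ) : ℝ := (4 - x) * (5 - x) - 1

/-- `r̃(x) = -2(5-x)`. -/
def rt (x : ℝ) : ℝ := -2 * (5 - x)

/-- `qt m` is the function `q̃_m` from the paper, meaningful for `m ≥ 2`. -/
def qt (m : ℕ) (x : ℝ) : ℝ :=
  if m = 2 then st x
  else if m = 3 then st (f x) * sf x - rt (f x) * lf x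
  else st (f^[m - 2] x) * q (m - 1) x - rt (f^[m - 2] x) * lf (f^[m - 3] x) * q (m - 2) x

theorem q_add_three (k : ℕ) (x : ℝ) :
    q (k + 3) x = sf (f^[k + 1] x) * q (k + 2) x -
      rf (f^[k + 1] x) * lf (f^[k] x) * q (k + 1) x := by
  cases k <;> simp [q]

theorem qt_add_three (k : ℕ) (x : ℝ) :
    qt (k + 3) x = st (f^[k + 1] x) * q (k + 2) x -
      rt (f^[k + 1] x) * lf (f^[k] x) * q (k + 1) x := by
  cases k <;> simp [qt, q]

/-- If `f^[k] x` is a zero of `r`, the recursion for `q` loses its second term. -/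
theorem q_add_two_of_rf_eq_zero {k : ℕ} {x : ℝ} (h : rf (f^[k] x) = 0) :
    q (k + 2) x = sf (f^[k] x) * q (k + 1) x := by
  cases k with
  | zero => simp [q]
  | succ k => rw [q_add_three, h]; ring

/-- If `f^[k] x` is a zero of `r̃`, the recursion for `q̃` loses its second term. -/
theorem qt_add_two_of_rt_eq_zero {k : ℕ} {x : ℝ} (h : rt (f^[k] x) = 0) :
    qt (k + 2) x = st (f^[k] x) * q (k + 1) x := by
  cases k with
  | zero => simp [q, qt]
  | succ k => rw [qt_add_three, h]; ring

section OrbitThroughTwo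

variable {i : ℕ} {x : ℝ}

theorem f_iterate_succ_of_eq_two (h : f^[i] x = 2) : f^[i + 1] x = 6 := by
  rw [iterate_succ_apply', h]; norm_num [f]

theorem q_add_two_of_eq_two (h : f^[i] x = 2) : q (i + 2) x = -8 * q (i + 1) x := by
  rw [q_add_two_of_rf_eq_zero (by norm_num [h, rf]), h]; norm_num [sf]

theorem q_eq_zero_of_eq_two (h : f^[i] x = 2) (n : ℕ) :
    q (i + n + 3) x = 0 ∧ q (i + n + 4) x = 0 := by
  induction n with
  | zero =>
    have h3 : q (i + 3) x = 0 := by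
      rw [q_add_three, f_iterate_succ_of_eq_two h, h, q_add_two_of_eq_two h]
      simp only [sf, rf, lf]; ring
    refine ⟨h3, ?_⟩
    rw [add_zero, q_add_three (i + 1), f_iterate_succ_of_eq_two h, h3]
    simp [lf]
  | succ n ih =>
    refine ⟨ih.2, ?_⟩
    rw [show i + (n + 1) + 4 = i + n + 2 + 3 by ring, q_add_three, ih.1, ih.2]
    ring

theorem qt_eq_zero_of_eq_two (h : f^[i] x = 2) (n : ℕ) : qt (i + n + 3) x = 0 := by
  rw [qt_add_three]
  match n with
  | 0 =>
    rw [add_zero, f_iterate_succ_of_eq_two h, h, q_add_two_of_eq_two h]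
    simp only [st, rt, lf]; ring
  | 1 =>
    rw [f_iterate_succ_of_eq_two h, (q_eq_zero_of_eq_two h 0).1]
    simp [lf]
  | n + 2 =>
    rw [show i + (n + 2) + 2 = i + n + 4 by ring, show i + (n + 2) + 1 = i + n + 3 by ring,
      (q_eq_zero_of_eq_two h n).2, (q_eq_zero_of_eq_two h n).1]
    ring

end OrbitThroughTwo

section OrbitThroughFive

variable {i : ℕ} {x : ℝ}

theorem f_iterate_add_of_eq_five (h : f^[i] x = 5) (n : ℕ) : f^[i + n + 1] x = 0 := by
  induction n with
  | zero => rw [add_zero, iterate_succ_apply', h]; norm_num [f]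
  | succ n ih => rw [iterate_succ_apply', ← add_assoc, ih]; simp [f]

theorem q_eq_of_eq_five (h : f^[i] x = 5) (n : ℕ) :
    q (i + n + 2) x = 6 ^ n * q (i + 1) x ∧ q (i + n + 3) x = 6 ^ (n + 1) * q (i + 1) x := by
  induction n with
  | zero =>
    have h2 : q (i + 2) x = q (i + 1) x := by
      rw [q_add_two_of_rf_eq_zero (by norm_num [h, rf]), h]; norm_num [sf]
    refine ⟨by simpa using h2, ?_⟩
    rw [add_zero, q_add_three, h2, f_iterate_add_of_eq_five h 0, h]
    simp only [sf, rf, lf]; ring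
  | succ n ih =>
    refine ⟨ih.2, ?_⟩
    rw [show i + (n + 1) + 3 = i + n + 1 + 3 by ring, q_add_three, ih.2, ih.1,
      f_iterate_add_of_eq_five h n, add_assoc i n 1, f_iterate_add_of_eq_five h (n + 1)]
    simp only [sf, rf, lf]; ring

/-- Once the orbit hits `5` at time `i`, all later `q̃` are nonzero multiples of `q (i + 1) x`. -/
theorem qt_ne_zero_of_eq_five (h : f^[i] x = 5) (hq : q (i + 1) x ≠ 0) (n : ℕ) :
    qt (i + n + 2) x ≠ 0 := by
  match n with
  | 0 =>
    rw [add_zero, qt_add_two_of_rt_eq_zero (by simp [h, rt]), h]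
    simpa [st] using hq
  | 1 =>
    have hv : qt (i + 3) x = 9 * q (i + 1) x := by
      have h2 : q (i + 2) x = q (i + 1) x := by simpa using (q_eq_of_eq_five h 0).1
      rw [qt_add_three, h2, f_iterate_add_of_eq_five h 0, h]
      simp only [st, rt, lf]; ring
    exact hv ▸ mul_ne_zero (by norm_num) hq
  | n + 2 =>
    have hv : qt (i + n + 1 + 3) x = 54 * 6 ^ n * q (i + 1) x := by
      rw [qt_add_three, (q_eq_of_eq_five h n).2, (q_eq_of_eq_five h n).1,
        f_iterate_add_of_eq_five h n, add_assoc i n 1, f_iterate_add_of_eq_five h (n + 1)]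
      simp only [st, rt, lf]; ring
    rw [show i + (n + 2) + 2 = i + n + 1 + 3 by ring, hv]
    exact mul_ne_zero (by positivity) hq

end OrbitThroughFive

/-- The `5`-adic valuation extends to `ℝ`. -/
theorem exists_valuationSubring_five_mem_nonunits :
    ∃ B : ValuationSubring ℝ, (5 : ℝ) ∈ B.nonunits := by
  let A : Subring ℝ := (Int.castRingHom ℝ).range
  have hI : Ideal.span {(5 : A)} ≠ ⊤ := by
    rw [Ne, Ideal.span_singleton_eq_top, isUnit_iff_exists_inv]
    rintro ⟨⟨_, n, rfl⟩, hn⟩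
    have hn' : (5 : ℝ) * n = 1 := congrArg Subtype.val hn
    have : (5 : ℤ) * n = 1 := by exact_mod_cast hn'
    omega
  obtain ⟨B, -, hB⟩ := Ideal.image_subset_nonunits_valuationSubring _ hI
  exact ⟨B, hB ⟨5, Ideal.mem_span_singleton_self _, rfl⟩⟩

section Residue

open IsLocalRing

variable {B : ValuationSubring ℝ}

theorem mem_nonunits_of_f_mem_nonunits (h5 : (5 : ℝ) ∈ B.nonunits) {y : ℝ}
    (hy : f y ∈ B.nonunits) : y ∈ B.nonunits := by
  rw [B.mem_nonunits_iff] at *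
  by_contra! h
  have h' : B.valuation (5 - y) = B.valuation y :=
    Valuation.map_sub_eq_of_lt_right _ (h5.trans_le h)
  rw [f, map_mul, h'] at hy
  exact hy.not_ge (one_le_mul h h)

theorem mem_nonunits_of_f_iterate_mem_nonunits (h5 : (5 : ℝ) ∈ B.nonunits) {x : ℝ} {i k : ℕ}
    (hk : k ≤ i) (hx : f^[i] x ∈ B.nonunits) : f^[k] x ∈ B.nonunits := by
  induction hk using Nat.decreasingInduction with
  | self => exact hx
  | of_succ k _ ih =>
    exact mem_nonunits_of_f_mem_nonunits h5 (by rwa [← iterate_succ_apply' f])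

theorem residue_five_eq_zero (h5 : (5 : ℝ) ∈ B.nonunits) : (5 : ResidueField B) = 0 := by
  have h : residue B 5 = 0 := (residue_eq_zero_iff _).2 (B.coe_mem_nonunits_iff.1 h5)
  rwa [map_ofNat] at h

theorem exists_residue_eq_zero {y : ℝ} (hy : y ∈ B.nonunits) :
    ∃ b : B, (b : ℝ) = y ∧ residue B b = 0 :=
  ⟨⟨y, B.nonunits_le hy⟩, rfl, (residue_eq_zero_iff _).2 (B.coe_mem_nonunits_iff.1 hy)⟩

theorem exists_residue_sf_eq_one (h5 : (5 : ℝ) ∈ B.nonunits) {y : ℝ} (hy : y ∈ B.nonunits) :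
    ∃ b : B, (b : ℝ) = sf y ∧ residue B b = 1 := by
  obtain ⟨a, rfl, ha⟩ := exists_residue_eq_zero hy
  refine ⟨(2 - a) * (4 - a) * (5 - a) - (14 - 3 * a), by push_cast [sf]; rfl, ?_⟩
  simp only [map_sub, map_mul, map_ofNat, ha]
  linear_combination 5 * residue_five_eq_zero h5

theorem exists_residue_rf_mul_lf_eq_zero (h5 : (5 : ℝ) ∈ B.nonunits) {y z : ℝ}
    (hy : y ∈ B.nonunits) (hz : z ∈ B.nonunits) :
    ∃ b : B, (b : ℝ) = rf y * lf z ∧ residue B b = 0 := by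
  obtain ⟨a, rfl, ha⟩ := exists_residue_eq_zero hy
  obtain ⟨c, rfl, hc⟩ := exists_residue_eq_zero hz
  refine ⟨-2 * (2 - a) * (5 - a) * (c - 6), by push_cast [rf, lf]; rfl, ?_⟩
  simp only [map_sub, map_mul, map_neg, map_ofNat, ha, hc]
  linear_combination 24 * residue_five_eq_zero h5

/-- If the orbit up to time `k` reduces to `0` modulo `5`, then `q (k + 1)` reduces to `1`. -/
theorem exists_residue_q_eq_one (h5 : (5 : ℝ) ∈ B.nonunits) {x : ℝ} (k : ℕ)
    (hx : ∀ j < k, f^[j] x ∈ B.nonunits) :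
    ∃ b : B, (b : ℝ) = q (k + 1) x ∧ residue B b = 1 := by
  induction k using Nat.strong_induction_on with
  | _ k ih =>
    match k with
    | 0 => exact ⟨1, by simp [q], map_one _⟩
    | 1 => exact exists_residue_sf_eq_one h5 (hx 0 one_pos)
    | k + 2 =>
      obtain ⟨a, ha, ha'⟩ := ih k (by omega) fun j hj => hx j (by omega)
      obtain ⟨b, hb, hb'⟩ := ih (k + 1) (by omega) fun j hj => hx j (by omega)
      obtain ⟨c, hc, hc'⟩ := exists_residue_sf_eq_one h5 (hx (k + 1) (by omega))
      obtain ⟨d, hd, hd'⟩ :=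
        exists_residue_rf_mul_lf_eq_zero h5 (hx (k + 1) (by omega)) (hx k (by omega))
      refine ⟨c * b - d * a, ?_, by simp [ha', hb', hc', hd']⟩
      rw [q_add_three, ← ha, ← hb, ← hc, ← hd]
      push_cast
      rfl

end Residue

theorem q_succ_ne_zero_of_eq_five {i : ℕ} {x : ℝ} (h : f^[i] x = 5) : q (i + 1) x ≠ 0 := by
  obtain ⟨B, h5⟩ := exists_valuationSubring_five_mem_nonunits
  obtain ⟨b, hb, hb'⟩ := exists_residue_q_eq_one h5 i fun j hj =>
    mem_nonunits_of_f_iterate_mem_nonunits h5 hj.le (h ▸ h5)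
  intro h0
  have : b = 0 := Subtype.ext (hb.trans h0)
  simp [this] at hb'

theorem statement_9 :
    (∀ m : ℕ, 3 ≤ m → ∀ x : ℝ, ∀ i : ℕ, i ≤ m - 3 → f^[i] x = 2 → qt m x = 0) ∧
    (∀ m : ℕ, 2 ≤ m → ∀ x : ℝ, ∀ i : ℕ, i ≤ m - 2 → f^[i] x = 5 → qt m x ≠ 0) := by
  refine ⟨fun m hm x i hi h => ?_, fun m hm x i hi h => ?_⟩
  · obtain ⟨n, rfl⟩ : ∃ n, m = i + n + 3 := ⟨m - 3 - i, by omega⟩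
    exact qt_eq_zero_of_eq_two h n
  · obtain ⟨n, rfl⟩ : ∃ n, m = i + n + 2 := ⟨m - 2 - i, by omega⟩
    exact qt_ne_zero_of_eq_five h (q_succ_ne_zero_of_eq_five h) n
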